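/- Assume the normalized biadjacency matrix of G satisfies the second-singular-value bound λ, and let Ẽ be an η-good k-tuple of pseudocodewords of degree t ≥ 4kd with λ ≤ β·ε/(12·k^k) and η ≤ β·ε/(12·k^k). Let τ* be a partition of [k] with at least 2 nonempty parts such that Ẽ[E_{ℓ∈L}[Λ_{ℓ,τ*}(Z)]] ≥ β/k^k, and let g ∈ Σ_in^E. Then for every S ⊆ [k]: Ẽ[E_{(ℓ,r)∈E}[Λ_{ℓ,τ*}(Z)·D_{S,r}(g,Z)]] / Ẽ[E_{ℓ∈L}[Λ_{ℓ,τ*}(Z)]] ≤ Ẽ[E_{r∈R}[D_{S,r}(g,Z)]] + ε/6, and the same inequality holds with D_{S,r} replaced by F_{S,r}. -/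

import Mathlib

open Finset MvPolynomial
open scoped Classical

noncomputable section

/-- The SoS variables `Z_{i,e,σ}`: one for each row `i ∈ [k]`, edge `e` (an edge of the
AEL graph, identified with a pair in `L × [d]`) and symbol `σ ∈ Σ_in`. -/
abbrev SoSVar (k n d : ℕ) (A : Type*) : Type _ := Fin k × (Fin n × Fin d) × A

variable {A : Type*} [Fintype A] {k n d : ℕ}

/-- The monomial `Z_{{i}×N(ℓ), a}` selecting local assignment `a` for row `i` at the
left vertex `ℓ`. -/
def ZL (i : Fin k) (ℓ : Fin n) (a : Fin d → A) : MvPolynomial (SoSVar k n d A) ℝ :=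
  ∏ j : Fin d, X (i, (ℓ, j), a j)

/-- The monomial `Z_{{i}×N(r), a}` selecting local assignment `a` for row `i` at the
right vertex `r` (via the right identification `eR` of edges). -/
def ZR (eR : Fin n × Fin d ≃ Fin n × Fin d) (i : Fin k) (r : Fin n) (a : Fin d → A) :
    MvPolynomial (SoSVar k n d A) ℝ :=
  ∏ j : Fin d, X (i, eR.symm (r, j), a j)

/-- A degree-`t` pseudoexpectation: a linear functional with `Ẽ[1]=1`, nonnegative on
squares of degree ≤ t/2, and respecting the Boolean and normalization constraints. -/
def IsPseudoExpectation (PE : MvPolynomial (SoSVar k n d A) ℝ →ₗ[ℝ] ℝ) (t : ℕ) : Prop :=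
  PE 1 = 1 ∧
  (∀ p : MvPolynomial (SoSVar k n d A) ℝ, 2 * p.totalDegree ≤ t → 0 ≤ PE (p ^ 2)) ∧
  (∀ (p : MvPolynomial (SoSVar k n d A) ℝ) (v : SoSVar k n d A),
      p.totalDegree + 2 ≤ t → PE (p * (X v ^ 2 - X v)) = 0) ∧
  (∀ (p : MvPolynomial (SoSVar k n d A) ℝ) (i : Fin k) (e : Fin n × Fin d),
      p.totalDegree + 1 ≤ t → PE (p * ((∑ σ : A, X (i, e, σ)) - 1)) = 0)

/-- A `k`-tuple of pseudocodewords of degree `t`: a degree-`t` pseudoexpectation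
additionally annihilating local assignments outside the inner code. -/
def IsPseudocodeword (Cin : Set (Fin d → A)) (PE : MvPolynomial (SoSVar k n d A) ℝ →ₗ[ℝ] ℝ)
    (t : ℕ) : Prop :=
  IsPseudoExpectation PE t ∧
  ∀ (p : MvPolynomial (SoSVar k n d A) ℝ) (i : Fin k) (ℓ : Fin n) (a : Fin d → A),
    a ∉ Cin → p.totalDegree + d ≤ t → PE (p * ZL i ℓ a) = 0

/-- The pseudo left distance `Ẽ[Δ_L(Z_i, Z_{i'})]`. -/
def pdeltaL (PE : MvPolynomial (SoSVar k n d A) ℝ →ₗ[ℝ] ℝ) (i i' : Fin k) : ℝ :=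
  (∑ ℓ : Fin n, PE (∑ a : Fin d → A, ∑ b : Fin d → A,
      if a ≠ b then ZL i ℓ a * ZL i' ℓ b else 0)) / n

/-- The polynomial `D_{S,r}(g,Z)`: the indicator that `r` is a common error location for
all rows `i ∈ S` with respect to `g`. -/
def Dpoly (eR : Fin n × Fin d ≃ Fin n × Fin d) (g : Fin n × Fin d → A)
    (S : Finset (Fin k)) (r : Fin n) : MvPolynomial (SoSVar k n d A) ℝ :=
  ∏ i ∈ S, ∑ a : Fin d → A,
    if a ≠ (fun j => g (eR.symm (r, j))) then ZR eR i r a else 0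

/-- The pseudo right distance `Ẽ[Δ_R(g, Z_S)]` (common errors of the rows in `S`). -/
def pdeltaR (eR : Fin n × Fin d ≃ Fin n × Fin d)
    (PE : MvPolynomial (SoSVar k n d A) ℝ →ₗ[ℝ] ℝ)
    (g : Fin n × Fin d → A) (S : Finset (Fin k)) : ℝ :=
  (∑ r : Fin n, PE (Dpoly eR g S r)) / n

/-- The monomial `Z_{T,γ}` for a set `T ⊆ [k] × E` and assignment `γ : T → Σ_in`. -/
def ZA (T : Finset (Fin k × (Fin n × Fin d))) (γ : {x // x ∈ T} → A) :
    MvPolynomial (SoSVar k n d A) ℝ :=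
  ∏ x : {x // x ∈ T}, X (x.1.1, x.1.2, γ x)

/-- Pseudocovariance of the coordinate sets `T1, T2` with respect to an operator `F`. -/
def CovF (F : MvPolynomial (SoSVar k n d A) ℝ → ℝ)
    (T1 T2 : Finset (Fin k × (Fin n × Fin d))) : ℝ :=
  ∑ a : {x // x ∈ T1} → A, ∑ b : {x // x ∈ T2} → A,
    |F (ZA T1 a * ZA T2 b) - F (ZA T1 a) * F (ZA T2 b)|

/-- The set `[k] × N(ℓ)` of coordinates. -/
def KNL (k : ℕ) {n : ℕ} (d : ℕ) (ℓ : Fin n) : Finset (Fin k × (Fin n × Fin d)) :=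
  Finset.univ ×ˢ (Finset.univ.image fun j : Fin d => ((ℓ, j) : Fin n × Fin d))

/-- The set `[k] × N(r)` of coordinates. -/
def KNR (k : ℕ) {n d : ℕ} (eR : Fin n × Fin d ≃ Fin n × Fin d) (r : Fin n) :
    Finset (Fin k × (Fin n × Fin d)) :=
  Finset.univ ×ˢ (Finset.univ.image fun j : Fin d => eR.symm (r, j))

/-- `Ẽ` is `η`-good: the average pseudocovariance between the local coordinate sets of a
uniformly random left vertex and a uniformly random right vertex is at most `η`. -/
def EtaGood (eR : Fin n × Fin d ≃ Fin n × Fin d)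
    (PE : MvPolynomial (SoSVar k n d A) ℝ →ₗ[ℝ] ℝ) (η : ℝ) : Prop :=
  (∑ ℓ : Fin n, ∑ r : Fin n, CovF (fun p => PE p) (KNL k d ℓ) (KNR k eR r)) / ((n : ℝ) * n) ≤ η

/-- The second-singular-value bound `λ` for the normalized biadjacency matrix. -/
def SingularBound (eR : Fin n × Fin d ≃ Fin n × Fin d) (lam : ℝ) : Prop :=
  ∀ x : Fin n → ℝ,
    Real.sqrt (∑ ℓ : Fin n,
        ((∑ j : Fin d, x ((eR (ℓ, j)).1)) / d - (∑ r : Fin n, x r) / n) ^ 2)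
      ≤ lam * Real.sqrt (∑ r : Fin n, x r ^ 2)

/-- `i` and `i'` lie in the same part of the partition `τ` of `[k]`. -/
def SamePart (τ : Finpartition (Finset.univ : Finset (Fin k))) (i i' : Fin k) : Prop :=
  ∃ P ∈ τ.parts, i ∈ P ∧ i' ∈ P

/-- The indicator polynomial `Λ_{ℓ,τ}(Z)` of the event that the local assignments at
`ℓ` induce exactly the partition `τ` of `[k]`. -/
def Lam (τ : Finpartition (Finset.univ : Finset (Fin k))) (ℓ : Fin n) :
    MvPolynomial (SoSVar k n d A) ℝ :=
  ∑ a : Fin k → Fin d → A,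
    if ∀ i i' : Fin k, (a i = a i' ↔ SamePart τ i i') then ∏ i : Fin k, ZL i ℓ (a i) else 0

/-- Fraction of erased coordinates of a partially erased word. -/
def eraseFrac {ι B : Type*} [Fintype ι] (g : ι → Option B) : ℝ :=
  ((Finset.univ.filter fun i => g i = none).card : ℝ) / (Fintype.card ι)

/-- Distance of a partially erased word to a word (non-erased disagreements only). -/
def deltaE {ι B : Type*} [Fintype ι] (g : ι → Option B) (h : ι → B) : ℝ :=
  ((Finset.univ.filter fun i => g i ≠ none ∧ g i ≠ some (h i)).card : ℝ) / (Fintype.card ι)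

/-- `(δ, k, ε)` average-radius list decodable with erasures. -/
def ARLDE {ι B : Type*} [Fintype ι] (C : Set (ι → B)) (δ : ℝ) (k : ℕ) (ε : ℝ) : Prop :=
  ∀ g : ι → Option B, ∀ H : Finset (ι → B), ↑H ⊆ C → H.card ≤ k →
    ((H.card : ℝ) - 1) * (δ - eraseFrac g - ε) ≤ ∑ h ∈ H, deltaE g h

lemma IsPseudoExpectation.map_mul_prod_sq {PE : MvPolynomial (SoSVar k n d A) ℝ →ₗ[ℝ] ℝ} {t : ℕ}
    (h : IsPseudoExpectation PE t) {ι : Type*} (f : ι → SoSVar k n d A) (s : Finset ι) :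
    ∀ p : MvPolynomial (SoSVar k n d A) ℝ, p.totalDegree + 2 * s.card ≤ t →
      PE (p * ∏ x ∈ s, X (f x) ^ 2) = PE (p * ∏ x ∈ s, X (f x)) := by
  induction s using Finset.induction_on with
  | empty => intro p _; simp
  | insert a s ha ih =>
    intro p hp
    rw [Finset.card_insert_of_notMem ha] at hp
    rw [Finset.prod_insert ha, Finset.prod_insert ha]
    have hX : (X (f a) ^ 2 : MvPolynomial (SoSVar k n d A) ℝ).totalDegree = 2 :=
      totalDegree_X_pow _ _
    have h1 := totalDegree_mul p (X (f a) ^ 2)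
    have h2 := totalDegree_mul p (∏ x ∈ s, X (f x))
    have h3 := totalDegree_finsetProd s (fun x => (X (f x) : MvPolynomial (SoSVar k n d A) ℝ))
    simp only [totalDegree_X, Finset.sum_const, smul_eq_mul, mul_one] at h3
    have h4 := h.2.2.1 (p * ∏ x ∈ s, X (f x)) (f a) (by omega)
    rw [mul_sub, map_sub, sub_eq_zero] at h4
    calc PE (p * (X (f a) ^ 2 * ∏ x ∈ s, X (f x) ^ 2))
        = PE (p * X (f a) ^ 2 * ∏ x ∈ s, X (f x) ^ 2) := by rw [mul_assoc]
      _ = PE (p * X (f a) ^ 2 * ∏ x ∈ s, X (f x)) := ih _ (by omega)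
      _ = PE (p * (∏ x ∈ s, X (f x)) * X (f a) ^ 2) := by rw [mul_right_comm]
      _ = PE (p * (∏ x ∈ s, X (f x)) * X (f a)) := h4
      _ = PE (p * (X (f a) * ∏ x ∈ s, X (f x))) := by rw [mul_assoc, mul_comm (X (f a))]

lemma totalDegree_sum_X_le (i : Fin k) (e : Fin n × Fin d) :
    (∑ σ : A, X (i, e, σ) : MvPolynomial (SoSVar k n d A) ℝ).totalDegree ≤ 1 :=
  totalDegree_finsetSum_le fun _ _ => (totalDegree_X _).le

lemma IsPseudoExpectation.map_mul_prod_sum {PE : MvPolynomial (SoSVar k n d A) ℝ →ₗ[ℝ] ℝ} {t : ℕ}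
    (h : IsPseudoExpectation PE t) {ι : Type*} (f : ι → Fin k × (Fin n × Fin d)) (s : Finset ι) :
    ∀ p : MvPolynomial (SoSVar k n d A) ℝ, p.totalDegree + s.card ≤ t →
      PE (p * ∏ x ∈ s, ∑ σ : A, X ((f x).1, (f x).2, σ)) = PE p := by
  induction s using Finset.induction_on with
  | empty => intro p _; simp
  | insert a s ha ih =>
    intro p hp
    rw [Finset.card_insert_of_notMem ha] at hp
    rw [Finset.prod_insert ha, ← mul_assoc]
    have h1 := totalDegree_mul p (∑ σ : A, X ((f a).1, (f a).2, σ))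
    have h2 := totalDegree_sum_X_le (A := A) (f a).1 (f a).2
    have h4 := h.2.2.2 p (f a).1 (f a).2 (by omega)
    rw [mul_sub, map_sub, mul_one, sub_eq_zero] at h4
    rw [ih _ (by omega), h4]

/-- Polynomials with vanishing pseudo second moment annihilate everything of low degree. -/
lemma IsPseudoExpectation.map_mul_eq_zero {PE : MvPolynomial (SoSVar k n d A) ℝ →ₗ[ℝ] ℝ} {t : ℕ}
    (h : IsPseudoExpectation PE t) {p u : MvPolynomial (SoSVar k n d A) ℝ}
    (hp : 2 * p.totalDegree ≤ t) (hu : 2 * u.totalDegree ≤ t) (hu0 : PE (u ^ 2) = 0) :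
    PE (p * u) = 0 := by
  by_contra hne
  have key : ∀ c : ℝ, 0 ≤ PE (p ^ 2) + 2 * c * PE (p * u) := by
    intro c
    have h1 := totalDegree_add p (c • u)
    have h2 := totalDegree_smul_le c u
    have h3 := h.2.1 (p + c • u) (by
      rcases le_max_iff.1 h1 with h1 | h1 <;> omega)
    have h4 : (p + c • u) ^ 2 = p ^ 2 + (2 * c) • (p * u) + (c ^ 2) • u ^ 2 := by
      simp only [smul_eq_C_mul, map_mul, map_pow, map_ofNat]; ring
    rw [h4, map_add, map_add, map_smul, map_smul, hu0] at h3
    simpa using h3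
  have := key (-(PE (p ^ 2) + 1) / (2 * PE (p * u)))
  field_simp at this
  linarith

lemma IsPseudoExpectation.map_mul_X_mul_X {PE : MvPolynomial (SoSVar k n d A) ℝ →ₗ[ℝ] ℝ} {t : ℕ}
    (h : IsPseudoExpectation PE t) (ht : 4 ≤ t) {p : MvPolynomial (SoSVar k n d A) ℝ}
    (hp : 2 * p.totalDegree ≤ t) (i : Fin k) (e : Fin n × Fin d) {σ σ' : A} (hσ : σ ≠ σ') :
    PE (p * (X (i, e, σ) * X (i, e, σ'))) = 0 := by
  have hdeg : ∀ ρ : A, (X (i, e, σ) * X (i, e, ρ) :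
      MvPolynomial (SoSVar k n d A) ℝ).totalDegree ≤ 2 := fun ρ =>
    (totalDegree_mul _ _).trans (by simp [totalDegree_X])
  have hsq : ∀ ρ : A, ρ ≠ σ → PE ((X (i, e, σ) * X (i, e, ρ)) ^ 2)
      = PE (X (i, e, σ) * X (i, e, ρ)) := by
    intro ρ hρ
    have := h.map_mul_prod_sq (fun ρ : A => ((i, e, ρ) : SoSVar k n d A)) {σ, ρ} 1
      (by rw [Finset.card_pair hρ.symm]; simpa using ht)
    simpa [Finset.prod_pair hρ.symm, mul_pow] using this
  have hnn : ∀ ρ : A, ρ ≠ σ → 0 ≤ PE (X (i, e, σ) * X (i, e, ρ)) := fun ρ hρ => by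
    rw [← hsq ρ hρ]
    exact h.2.1 _ (by have := hdeg ρ; omega)
  have hsum : ∑ ρ ∈ univ.erase σ, PE (X (i, e, σ) * X (i, e, ρ)) = 0 := by
    have h1 := h.2.2.2 (X (i, e, σ)) i e (by rw [totalDegree_X]; omega)
    have h2 := h.2.2.1 1 (i, e, σ) (by simp; omega)
    rw [← Finset.add_sum_erase _ _ (Finset.mem_univ σ), add_sub_right_comm, mul_add, map_add,
      Finset.mul_sum, map_sum] at h1
    have h3 : (X (i, e, σ) * (X (i, e, σ) - 1) : MvPolynomial (SoSVar k n d A) ℝ)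
        = 1 * (X (i, e, σ) ^ 2 - X (i, e, σ)) := by ring
    rwa [h3, h2, zero_add] at h1
  have hz := (Finset.sum_eq_zero_iff_of_nonneg (fun ρ hρ => hnn ρ (Finset.ne_of_mem_erase hρ))).1
    hsum σ' (by simp [hσ.symm])
  exact h.map_mul_eq_zero hp (by have := hdeg σ'; omega) (by rw [hsq σ' hσ.symm, hz])

/-- The monomial assigning `α i j` to row `i` at the edge `e j`. -/
def localMono (e : Fin d → Fin n × Fin d) (α : Fin k → Fin d → A) :
    MvPolynomial (SoSVar k n d A) ℝ :=
  ∏ x : Fin k × Fin d, X (x.1, e x.2, α x.1 x.2)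

/-- The polynomial representing the function `v` of the local assignment on the edges `e`. -/
def localPoly (e : Fin d → Fin n × Fin d) (v : (Fin k → Fin d → A) → ℝ) :
    MvPolynomial (SoSVar k n d A) ℝ :=
  ∑ α, v α • localMono e α

lemma totalDegree_localMono_le (e : Fin d → Fin n × Fin d) (α : Fin k → Fin d → A) :
    (localMono e α).totalDegree ≤ k * d := by
  refine (totalDegree_finsetProd _ _).trans ?_
  simp [totalDegree_X]

lemma totalDegree_localPoly_le (e : Fin d → Fin n × Fin d) (v : (Fin k → Fin d → A) → ℝ) :
    (localPoly e v).totalDegree ≤ k * d :=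
  totalDegree_finsetSum_le fun α _ =>
    (totalDegree_smul_le _ _).trans (totalDegree_localMono_le e α)

lemma IsPseudoExpectation.map_localMono_mul_self
    {PE : MvPolynomial (SoSVar k n d A) ℝ →ₗ[ℝ] ℝ} {t : ℕ}
    (h : IsPseudoExpectation PE t) (ht : 4 * (k * d) ≤ t)
    (e : Fin d → Fin n × Fin d) (α : Fin k → Fin d → A) :
    PE (localMono e α * localMono e α) = PE (localMono e α) := by
  have := h.map_mul_prod_sq (fun x : Fin k × Fin d => ((x.1, e x.2, α x.1 x.2) : SoSVar k n d A))
    univ 1 (by simp; omega)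
  rw [one_mul, one_mul, Finset.prod_pow, sq] at this
  exact this

lemma IsPseudoExpectation.map_localMono_nonneg
    {PE : MvPolynomial (SoSVar k n d A) ℝ →ₗ[ℝ] ℝ} {t : ℕ}
    (h : IsPseudoExpectation PE t) (ht : 4 * (k * d) ≤ t)
    (e : Fin d → Fin n × Fin d) (α : Fin k → Fin d → A) :
    0 ≤ PE (localMono e α) := by
  rw [← h.map_localMono_mul_self ht, ← sq]
  exact h.2.1 _ (by have := totalDegree_localMono_le e α; omega)

lemma IsPseudoExpectation.map_localMono_mul_of_ne
    {PE : MvPolynomial (SoSVar k n d A) ℝ →ₗ[ℝ] ℝ} {t : ℕ}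
    (h : IsPseudoExpectation PE t) (ht : 4 * (k * d) ≤ t)
    (e : Fin d → Fin n × Fin d) {α β : Fin k → Fin d → A} (hαβ : α ≠ β) :
    PE (localMono e α * localMono e β) = 0 := by
  obtain ⟨i, j, hij⟩ : ∃ i j, α i j ≠ β i j := by
    by_contra! hc
    exact hαβ (by ext i j; exact hc i j)
  have hkd : 1 ≤ k * d := Nat.mul_pos (Fin.pos i) (Fin.pos j)
  have hsplit : ∀ γ : Fin k → Fin d → A, localMono e γ = X (i, e j, γ i j) *
      ∏ x ∈ univ.erase (i, j), X (x.1, e x.2, γ x.1 x.2) := fun γ =>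
    (Finset.mul_prod_erase univ (fun x : Fin k × Fin d =>
      (X (x.1, e x.2, γ x.1 x.2) : MvPolynomial (SoSVar k n d A) ℝ)) (Finset.mem_univ (i, j))).symm
  have hdeg : ∀ γ : Fin k → Fin d → A, (∏ x ∈ univ.erase (i, j), X (x.1, e x.2, γ x.1 x.2) :
      MvPolynomial (SoSVar k n d A) ℝ).totalDegree ≤ k * d := fun γ => by
    refine (totalDegree_finsetProd _ _).trans ?_
    simp [totalDegree_X]
  rw [hsplit α, hsplit β, mul_mul_mul_comm, mul_comm]
  refine h.map_mul_X_mul_X (by omega) ?_ i (e j) hij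
  have h1 := hdeg α
  have h2 := hdeg β
  have h3 := totalDegree_mul
    (∏ x ∈ univ.erase (i, j), X (x.1, e x.2, α x.1 x.2) : MvPolynomial (SoSVar k n d A) ℝ)
    (∏ x ∈ univ.erase (i, j), X (x.1, e x.2, β x.1 x.2))
  omega

lemma IsPseudoExpectation.map_localPoly_sq
    {PE : MvPolynomial (SoSVar k n d A) ℝ →ₗ[ℝ] ℝ} {t : ℕ}
    (h : IsPseudoExpectation PE t) (ht : 4 * (k * d) ≤ t)
    (e : Fin d → Fin n × Fin d) {v : (Fin k → Fin d → A) → ℝ} (hv : ∀ α, v α = 0 ∨ v α = 1) :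
    PE (localPoly e v ^ 2) = PE (localPoly e v) := by
  simp only [sq, localPoly, Finset.sum_mul_sum, map_sum, smul_mul_smul_comm, map_smul, smul_eq_mul]
  refine Finset.sum_congr rfl fun α _ => ?_
  rw [Finset.sum_eq_single α
    (fun β _ hβ => by rw [h.map_localMono_mul_of_ne ht e hβ.symm, mul_zero]) (by simp),
    h.map_localMono_mul_self ht]
  rcases hv α with h0 | h0 <;> simp [h0]

/-- A product over the rows of local functions is represented by the product of their values. -/
lemma prod_sum_localMono (e : Fin d → Fin n × Fin d) (f : Fin k → (Fin d → A) → ℝ) :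
    ∏ i : Fin k, ∑ a : Fin d → A,
        f i a • (∏ j : Fin d, X (i, e j, a j) : MvPolynomial (SoSVar k n d A) ℝ)
      = localPoly e fun α => ∏ i, f i (α i) := by
  rw [Finset.prod_univ_sum, Fintype.piFinset_univ]
  refine Finset.sum_congr rfl fun α _ => ?_
  rw [localMono, Fintype.prod_prod_type]
  simp only [smul_eq_C_mul, Finset.prod_mul_distrib, map_prod]

lemma sum_prod_X (e : Fin d → Fin n × Fin d) (i : Fin k) :
    ∑ a : Fin d → A, (∏ j : Fin d, X (i, e j, a j) : MvPolynomial (SoSVar k n d A) ℝ)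
      = ∏ j : Fin d, ∑ σ : A, X (i, e j, σ) := by
  rw [Finset.prod_univ_sum, Fintype.piFinset_univ]

lemma IsPseudoExpectation.sum_map_localMono
    {PE : MvPolynomial (SoSVar k n d A) ℝ →ₗ[ℝ] ℝ} {t : ℕ}
    (h : IsPseudoExpectation PE t) (ht : 4 * (k * d) ≤ t) (e : Fin d → Fin n × Fin d) :
    ∑ α : Fin k → Fin d → A, PE (localMono e α) = 1 := by
  have h1 := prod_sum_localMono (A := A) (k := k) e fun _ _ => 1
  simp only [one_smul, sum_prod_X, Finset.prod_const_one, localPoly] at h1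
  rw [← map_sum, ← h1, ← h.1, ← Fintype.prod_prod_type'
    (fun (i : Fin k) (j : Fin d) => (∑ σ : A, X (i, e j, σ) : MvPolynomial (SoSVar k n d A) ℝ))]
  have h2 := h.map_mul_prod_sum (fun x : Fin k × Fin d => (x.1, e x.2)) univ 1 (by simp; omega)
  rwa [one_mul] at h2

lemma IsPseudoExpectation.map_localPoly_nonneg
    {PE : MvPolynomial (SoSVar k n d A) ℝ →ₗ[ℝ] ℝ} {t : ℕ}
    (h : IsPseudoExpectation PE t) (ht : 4 * (k * d) ≤ t)
    (e : Fin d → Fin n × Fin d) {v : (Fin k → Fin d → A) → ℝ} (hv : ∀ α, v α = 0 ∨ v α = 1) :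
    0 ≤ PE (localPoly e v) := by
  rw [← h.map_localPoly_sq ht e hv]
  exact h.2.1 _ (by have := totalDegree_localPoly_le e v; omega)

lemma IsPseudoExpectation.map_localPoly_le_one
    {PE : MvPolynomial (SoSVar k n d A) ℝ →ₗ[ℝ] ℝ} {t : ℕ}
    (h : IsPseudoExpectation PE t) (ht : 4 * (k * d) ≤ t)
    (e : Fin d → Fin n × Fin d) {v : (Fin k → Fin d → A) → ℝ} (hv : ∀ α, v α = 0 ∨ v α = 1) :
    PE (localPoly e v) ≤ 1 := by
  rw [← h.sum_map_localMono ht e, localPoly, map_sum]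
  refine Finset.sum_le_sum fun α _ => ?_
  have := h.map_localMono_nonneg ht e α
  rw [map_smul, smul_eq_mul]
  rcases hv α with h0 | h0 <;> simp [h0, this]

lemma Lam_eq_localPoly (τ : Finpartition (Finset.univ : Finset (Fin k))) (ℓ : Fin n) :
    (Lam τ ℓ : MvPolynomial (SoSVar k n d A) ℝ) = localPoly (fun j => (ℓ, j))
      fun α => if ∀ i i' : Fin k, (α i = α i' ↔ SamePart τ i i') then 1 else 0 := by
  refine Finset.sum_congr rfl fun α _ => ?_
  simp only [ite_smul, one_smul, zero_smul, localMono, ZL, Fintype.prod_prod_type]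

/-- The indicator that every row in `S` of a local assignment differs from `a₀`. -/
def errIndicator (a₀ : Fin d → A) (S : Finset (Fin k)) (α : Fin k → Fin d → A) : ℝ :=
  ∏ i : Fin k, if i ∈ S → α i ≠ a₀ then 1 else 0

lemma errIndicator_eq (a₀ : Fin d → A) (S : Finset (Fin k)) (α : Fin k → Fin d → A) :
    errIndicator a₀ S α = if ∀ i ∈ S, α i ≠ a₀ then 1 else 0 := by
  simp [errIndicator, Finset.prod_boole]

lemma IsPseudoExpectation.map_mul_Dpoly
    {PE : MvPolynomial (SoSVar k n d A) ℝ →ₗ[ℝ] ℝ} {t : ℕ}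
    (h : IsPseudoExpectation PE t) (ht : 4 * (k * d) ≤ t)
    (eR : Fin n × Fin d ≃ Fin n × Fin d) (g : Fin n × Fin d → A) (S : Finset (Fin k)) (r : Fin n)
    {p : MvPolynomial (SoSVar k n d A) ℝ} (hp : p.totalDegree ≤ k * d) :
    PE (p * Dpoly eR g S r) = PE (p * localPoly (fun j => eR.symm (r, j))
      (errIndicator (fun j => g (eR.symm (r, j))) S)) := by
  have hD : (Dpoly eR g S r).totalDegree ≤ k * d := by
    refine (totalDegree_finsetProd _ _).trans ((Finset.sum_le_card_nsmul S _ d ?_).trans ?_)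
    · refine fun i _ => totalDegree_finsetSum_le fun a _ => ?_
      split_ifs
      · refine (totalDegree_finsetProd _ _).trans ?_
        simp [totalDegree_X]
      · simp
    · simpa using Nat.mul_le_mul_right d (card_finset_fin_le S)
  have hsplit : localPoly (fun j => eR.symm (r, j))
      (errIndicator (fun j => g (eR.symm (r, j))) S) = Dpoly eR g S r *
        ∏ x ∈ Sᶜ ×ˢ (univ : Finset (Fin d)), ∑ σ : A, X (x.1, eR.symm (r, x.2), σ) := by
    have := prod_sum_localMono (k := k) (fun j => eR.symm (r, j))
      fun i a => if i ∈ S → a ≠ (fun j => g (eR.symm (r, j))) then 1 else 0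
    unfold errIndicator
    rw [← this, ← Finset.prod_mul_prod_compl S, Finset.prod_product]
    congr 1
    · refine Finset.prod_congr rfl fun i hi => Finset.sum_congr rfl fun a _ => ?_
      simp [hi, ZR]
    · refine Finset.prod_congr rfl fun i hi => ?_
      rw [← sum_prod_X (fun j => eR.symm (r, j))]
      refine Finset.sum_congr rfl fun a _ => ?_
      simp [Finset.mem_compl.1 hi]
  rw [hsplit, ← mul_assoc]
  refine (h.map_mul_prod_sum (fun x : Fin k × Fin d => (x.1, eR.symm (r, x.2))) _ _ ?_).symm
  have h1 := totalDegree_mul p (Dpoly eR g S r)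
  have h2 : (Sᶜ ×ˢ (univ : Finset (Fin d))).card ≤ k * d := by
    refine (Finset.card_le_univ _).trans ?_
    simp
  omega

/-- The pairs `(i, e j)` enumerate the coordinate set `[k] × e([d])`. -/
def rowEdgeEquiv (k : ℕ) (e : Fin d → Fin n × Fin d) (he : Function.Injective e) :
    Fin k × Fin d ≃
      {x // x ∈ (Finset.univ : Finset (Fin k)) ×ˢ (Finset.univ.image e)} :=
  Equiv.ofBijective (fun x => ⟨(x.1, e x.2), by simp⟩) <| by
    constructor
    · rintro ⟨i, j⟩ ⟨i', j'⟩ h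
      simp only [Subtype.mk.injEq, Prod.mk.injEq] at h
      rw [h.1, he h.2]
    · rintro ⟨⟨i, y⟩, hy⟩
      simp only [Finset.mem_product, Finset.mem_image, Finset.mem_univ, true_and] at hy
      obtain ⟨j, rfl⟩ := hy
      exact ⟨(i, j), rfl⟩

lemma sum_ZA {e : Fin d → Fin n × Fin d} (he : Function.Injective e)
    (Φ : MvPolynomial (SoSVar k n d A) ℝ → ℝ) :
    ∑ γ, Φ (ZA (A := A) ((Finset.univ : Finset (Fin k)) ×ˢ (Finset.univ.image e)) γ)
      = ∑ α, Φ (localMono e α) := by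
  symm
  refine Fintype.sum_equiv ((Equiv.curry _ _ _).symm.trans
    (Equiv.arrowCongr (rowEdgeEquiv k e he) (Equiv.refl A))) _ _ fun α => ?_
  congr 1
  rw [localMono, ZA]
  refine Fintype.prod_equiv (rowEdgeEquiv k e he) _ _ fun x => ?_
  simp only [Equiv.trans_apply, Equiv.arrowCongr_apply, Function.comp, Equiv.symm_apply_apply]
  rfl

lemma CovF_eq {e e' : Fin d → Fin n × Fin d} (he : Function.Injective e)
    (he' : Function.Injective e') (F : MvPolynomial (SoSVar k n d A) ℝ → ℝ) :
    CovF F ((Finset.univ : Finset (Fin k)) ×ˢ (Finset.univ.image e))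
        ((Finset.univ : Finset (Fin k)) ×ˢ (Finset.univ.image e'))
      = ∑ α, ∑ β, |F (localMono e α * localMono e' β)
          - F (localMono e α) * F (localMono e' β)| := by
  rw [CovF, ← sum_ZA he fun p => ∑ β, |F (p * localMono e' β) - F p * F (localMono e' β)|]
  refine Finset.sum_congr rfl fun a _ => ?_
  exact sum_ZA he' fun q => |F (ZA _ a * q) - F (ZA _ a) * F q|

lemma map_localPoly_mul_le {e e' : Fin d → Fin n × Fin d} (he : Function.Injective e)
    (he' : Function.Injective e') (PE : MvPolynomial (SoSVar k n d A) ℝ →ₗ[ℝ] ℝ)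
    {w v : (Fin k → Fin d → A) → ℝ} (hw : ∀ α, w α = 0 ∨ w α = 1) (hv : ∀ α, v α = 0 ∨ v α = 1) :
    PE (localPoly e w * localPoly e' v) ≤ PE (localPoly e w) * PE (localPoly e' v)
      + CovF (fun p => PE p) ((Finset.univ : Finset (Fin k)) ×ˢ (Finset.univ.image e))
        ((Finset.univ : Finset (Fin k)) ×ˢ (Finset.univ.image e')) := by
  rw [CovF_eq he he', ← sub_le_iff_le_add']
  simp only [localPoly, Finset.sum_mul_sum, map_sum, smul_mul_smul_comm, map_smul, smul_eq_mul,
    ← Finset.sum_sub_distrib]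
  refine Finset.sum_le_sum fun α _ => Finset.sum_le_sum fun β _ => ?_
  have habs := le_abs_self (PE (localMono e α * localMono e' β)
    - PE (localMono e α) * PE (localMono e' β))
  have habs' := abs_nonneg (PE (localMono e α * localMono e' β)
    - PE (localMono e α) * PE (localMono e' β))
  rcases hw α with h0 | h0 <;> rcases hv β with h1 | h1 <;> simp [h0, h1] <;> linarith

lemma sum_map_sum_smul_sq (PE : MvPolynomial (SoSVar k n d A) ℝ →ₗ[ℝ] ℝ)
    {κ ι : Type*} [Fintype κ] [Fintype ι] (B : Matrix κ ι ℝ)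
    (b : ι → MvPolynomial (SoSVar k n d A) ℝ) :
    ∑ s, PE ((∑ r, B s r • b r) ^ 2)
      = ∑ r, ∑ r', (B.transpose * B) r r' * PE (b r * b r') := by
  simp only [sq, Finset.sum_mul_sum, map_sum, smul_mul_smul_comm, map_smul, smul_eq_mul]
  simp only [Matrix.mul_apply, Matrix.transpose_apply, Finset.sum_mul]
  rw [Finset.sum_comm]
  exact Finset.sum_congr rfl fun r _ => Finset.sum_comm

/-- Pseudoexpectations satisfy every quadratic inequality valid over the reals. -/
lemma IsPseudoExpectation.sum_posSemidef_nonneg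
    {PE : MvPolynomial (SoSVar k n d A) ℝ →ₗ[ℝ] ℝ} {t : ℕ} (h : IsPseudoExpectation PE t)
    {ι : Type*} [Fintype ι] {P : Matrix ι ι ℝ} (hP : P.PosSemidef)
    {b : ι → MvPolynomial (SoSVar k n d A) ℝ} (hb : ∀ r, 2 * (b r).totalDegree ≤ t) :
    0 ≤ ∑ r, ∑ r', P r r' * PE (b r * b r') := by
  obtain ⟨m, B, rfl⟩ := Matrix.posSemidef_iff_eq_sum_vecMulVec.1 hP
  have hB : ∑ s, Matrix.vecMulVec (B s) (star (B s))
      = (Matrix.of B).transpose * Matrix.of B := by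
    ext r r'
    simp [Matrix.sum_apply, Matrix.vecMulVec_apply, Matrix.mul_apply]
  rw [hB, ← sum_map_sum_smul_sq]
  refine Finset.sum_nonneg fun s _ => h.2.1 _ ?_
  have : (∑ r, Matrix.of B s r • b r).totalDegree ≤ t / 2 := totalDegree_finsetSum_le fun r _ =>
    (totalDegree_smul_le _ _).trans (by have := hb r; omega)
  omega

/-- Deviation of the average of `x` over the neighbours of `ℓ` from its global average,
as a matrix acting on `x`. -/
def deviationMatrix (eR : Fin n × Fin d ≃ Fin n × Fin d) : Matrix (Fin n) (Fin n) ℝ :=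
  fun ℓ r => (∑ j : Fin d, if (eR (ℓ, j)).1 = r then 1 else 0) / d - 1 / n

lemma sum_deviationMatrix_smul {V : Type*} [AddCommGroup V] [Module ℝ V]
    (eR : Fin n × Fin d ≃ Fin n × Fin d) (x : Fin n → V) (ℓ : Fin n) :
    ∑ r, deviationMatrix eR ℓ r • x r
      = (1 / d : ℝ) • ∑ j : Fin d, x (eR (ℓ, j)).1 - (1 / n : ℝ) • ∑ r, x r := by
  simp only [deviationMatrix, sub_smul, Finset.sum_sub_distrib, Finset.smul_sum, Finset.sum_div,
    Finset.sum_smul]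
  congr 1
  rw [Finset.sum_comm]
  refine Finset.sum_congr rfl fun j _ => ?_
  simp [ite_div, ite_smul]

lemma SingularBound.posSemidef {eR : Fin n × Fin d ≃ Fin n × Fin d} {lam : ℝ}
    (h : SingularBound eR lam) :
    (lam ^ 2 • (1 : Matrix (Fin n) (Fin n) ℝ)
      - (deviationMatrix eR).transpose * deviationMatrix eR).PosSemidef := by
  refine Matrix.PosSemidef.of_dotProduct_mulVec_nonneg ?_ fun x => ?_
  · simp [Matrix.IsHermitian]
  · have h1 := h x
    have h2 : ∀ ℓ, (deviationMatrix eR).mulVec x ℓ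
        = (∑ j : Fin d, x ((eR (ℓ, j)).1)) / d - (∑ r : Fin n, x r) / n := fun ℓ => by
      have := sum_deviationMatrix_smul eR x ℓ
      simp only [smul_eq_mul] at this
      rw [Matrix.mulVec, dotProduct, this]
      ring
    simp only [← h2] at h1
    have h3 := pow_le_pow_left₀ (Real.sqrt_nonneg _) h1 2
    rw [mul_pow, Real.sq_sqrt (by positivity), Real.sq_sqrt (by positivity)] at h3
    rw [star_trivial, Matrix.sub_mulVec, dotProduct_sub, ← Matrix.mulVec_mulVec,
      Matrix.dotProduct_mulVec x (deviationMatrix eR).transpose, Matrix.vecMul_transpose, Matrix.smul_mulVec, Matrix.one_mulVec,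
      dotProduct_smul, smul_eq_mul, sub_nonneg]
    simpa only [dotProduct, ← sq] using h3

lemma IsPseudoExpectation.sum_map_deviation_sq_le
    {PE : MvPolynomial (SoSVar k n d A) ℝ →ₗ[ℝ] ℝ} {t : ℕ} (h : IsPseudoExpectation PE t)
    {eR : Fin n × Fin d ≃ Fin n × Fin d} {lam : ℝ} (hs : SingularBound eR lam)
    {b : Fin n → MvPolynomial (SoSVar k n d A) ℝ} (hb : ∀ r, 2 * (b r).totalDegree ≤ t) :
    ∑ ℓ, PE ((∑ r, deviationMatrix eR ℓ r • b r) ^ 2) ≤ lam ^ 2 * ∑ r, PE (b r ^ 2) := by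
  have h1 := h.sum_posSemidef_nonneg hs.posSemidef hb
  have h2 : ∑ ℓ, PE ((∑ r, deviationMatrix eR ℓ r • b r) ^ 2) = ∑ r, ∑ r',
      ((deviationMatrix eR).transpose * deviationMatrix eR) r r' * PE (b r * b r') :=
    sum_map_sum_smul_sq PE _ b
  simp only [Matrix.sub_apply, Matrix.smul_apply, Matrix.one_apply, sub_mul,
    Finset.sum_sub_distrib, ← h2, smul_eq_mul, mul_ite, mul_one, mul_zero, ite_mul, zero_mul,
    Finset.sum_ite_eq, Finset.mem_univ, if_true, ← sq, ← Finset.mul_sum] at h1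
  linarith

/-- Expander mixing for pseudoexpectations. -/
lemma IsPseudoExpectation.expander_mixing
    {PE : MvPolynomial (SoSVar k n d A) ℝ →ₗ[ℝ] ℝ} {t : ℕ} (h : IsPseudoExpectation PE t)
    {eR : Fin n × Fin d ≃ Fin n × Fin d} {lam : ℝ} (hs : SingularBound eR lam) (hlam : 0 < lam)
    {a b : Fin n → MvPolynomial (SoSVar k n d A) ℝ} (ha : ∀ r, 2 * (a r).totalDegree ≤ t)
    (hb : ∀ r, 2 * (b r).totalDegree ≤ t) (ha1 : ∀ r, PE (a r ^ 2) ≤ 1)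
    (hb1 : ∀ r, PE (b r ^ 2) ≤ 1) :
    (∑ e : Fin n × Fin d, PE (a e.1 * b (eR e).1)) / d
      ≤ (∑ ℓ, ∑ r, PE (a ℓ * b r)) / n + lam * n := by
  set c : Fin n → MvPolynomial (SoSVar k n d A) ℝ := fun ℓ => ∑ r, deviationMatrix eR ℓ r • b r
    with hc
  have hcdeg : ∀ ℓ, (c ℓ).totalDegree ≤ t / 2 := fun ℓ => totalDegree_finsetSum_le fun r _ =>
    (totalDegree_smul_le _ _).trans (by have := hb r; omega)
  have hsum : (∑ e : Fin n × Fin d, PE (a e.1 * b (eR e).1)) / d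
      - (∑ ℓ, ∑ r, PE (a ℓ * b r)) / n = ∑ ℓ, PE (a ℓ * c ℓ) := by
    rw [Fintype.sum_prod_type, Finset.sum_div, Finset.sum_div, ← Finset.sum_sub_distrib]
    refine Finset.sum_congr rfl fun ℓ _ => ?_
    simp only [hc, sum_deviationMatrix_smul, mul_sub, mul_smul_comm, map_sub, map_smul,
      Finset.mul_sum, map_sum, smul_eq_mul]
    rw [← Finset.mul_sum, ← Finset.mul_sum]
    ring
  have hcs : ∀ ℓ, 2 * lam * PE (a ℓ * c ℓ) ≤ lam ^ 2 * PE (a ℓ ^ 2) + PE (c ℓ ^ 2) := fun ℓ => by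
    have h1 := totalDegree_sub (lam • a ℓ) (c ℓ)
    have h2 := totalDegree_smul_le lam (a ℓ)
    have h3 := ha ℓ
    have h4 := hcdeg ℓ
    have h5 := h.2.1 (lam • a ℓ - c ℓ) (by rcases le_max_iff.1 h1 with h1 | h1 <;> omega)
    have h6 : (lam • a ℓ - c ℓ) ^ 2
        = lam ^ 2 • a ℓ ^ 2 - (2 * lam) • (a ℓ * c ℓ) + c ℓ ^ 2 := by
      simp only [smul_eq_C_mul, map_mul, map_pow, map_ofNat]; ring
    rw [h6, map_add, map_sub, map_smul, map_smul, smul_eq_mul, smul_eq_mul] at h5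
    linarith
  have hA : ∑ ℓ, PE (a ℓ ^ 2) ≤ n := by
    simpa using Finset.sum_le_sum fun ℓ (_ : ℓ ∈ univ) => ha1 ℓ
  have hB : ∑ ℓ, PE (b ℓ ^ 2) ≤ n := by
    simpa using Finset.sum_le_sum fun ℓ (_ : ℓ ∈ univ) => hb1 ℓ
  have hC := h.sum_map_deviation_sq_le hs hb
  have htot := Finset.sum_le_sum fun ℓ (_ : ℓ ∈ univ) => hcs ℓ
  rw [← Finset.mul_sum, Finset.sum_add_distrib, ← Finset.mul_sum, ← hsum] at htot
  have hl2 := sq_nonneg lam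
  have hfin : 2 * lam * ((∑ e : Fin n × Fin d, PE (a e.1 * b (eR e).1)) / d
      - (∑ ℓ, ∑ r, PE (a ℓ * b r)) / n) ≤ 2 * lam * (lam * n) := by
    nlinarith [mul_le_mul_of_nonneg_left hA hl2, mul_le_mul_of_nonneg_left hB hl2]
  linarith [le_of_mul_le_mul_left hfin (by positivity)]

/-- Correlation of `0/1`-valued local functions along a random edge. -/
lemma IsPseudoExpectation.edge_correlation_le
    {PE : MvPolynomial (SoSVar k n d A) ℝ →ₗ[ℝ] ℝ} {t : ℕ} (h : IsPseudoExpectation PE t)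
    (ht : 4 * (k * d) ≤ t) (hn : 0 < n)
    {eR : Fin n × Fin d ≃ Fin n × Fin d} {lam η : ℝ} (hs : SingularBound eR lam) (hlam : 0 < lam)
    (hgood : EtaGood eR PE η) {w v : Fin n → (Fin k → Fin d → A) → ℝ}
    (hw : ∀ ℓ α, w ℓ α = 0 ∨ w ℓ α = 1) (hv : ∀ r α, v r α = 0 ∨ v r α = 1) :
    (∑ e : Fin n × Fin d, PE (localPoly (fun j => (e.1, j)) (w e.1)
        * localPoly (fun j => eR.symm ((eR e).1, j)) (v (eR e).1))) / ((n : ℝ) * d)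
      ≤ (∑ ℓ, PE (localPoly (fun j => (ℓ, j)) (w ℓ))) / n
          * ((∑ r, PE (localPoly (fun j => eR.symm (r, j)) (v r))) / n) + lam + η := by
  have hn' : (0 : ℝ) < n := by exact_mod_cast hn
  have hdeg : ∀ (e : Fin d → Fin n × Fin d) (u : (Fin k → Fin d → A) → ℝ),
      2 * (localPoly e u).totalDegree ≤ t := fun e u => by
    have := totalDegree_localPoly_le e u; omega
  have h1 := h.expander_mixing hs hlam (a := fun ℓ => localPoly (fun j => (ℓ, j)) (w ℓ))
    (b := fun r => localPoly (fun j => eR.symm (r, j)) (v r))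
    (fun ℓ => hdeg _ _) (fun r => hdeg _ _)
    (fun ℓ => (h.map_localPoly_sq ht _ (hw ℓ)).trans_le (h.map_localPoly_le_one ht _ (hw ℓ)))
    (fun r => (h.map_localPoly_sq ht _ (hv r)).trans_le (h.map_localPoly_le_one ht _ (hv r)))
  have h2 : ∑ ℓ, ∑ r, PE (localPoly (fun j => (ℓ, j)) (w ℓ)
        * localPoly (fun j => eR.symm (r, j)) (v r))
      ≤ (∑ ℓ, PE (localPoly (fun j => (ℓ, j)) (w ℓ)))
          * (∑ r, PE (localPoly (fun j => eR.symm (r, j)) (v r)))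
        + ∑ ℓ, ∑ r, CovF (fun p => PE p) (KNL k d ℓ) (KNR k eR r) := by
    rw [Finset.sum_mul_sum, ← Finset.sum_add_distrib]
    refine Finset.sum_le_sum fun ℓ _ => ?_
    rw [← Finset.sum_add_distrib]
    refine Finset.sum_le_sum fun r _ => ?_
    exact map_localPoly_mul_le (fun j j' hj => (Prod.mk.inj hj).2)
      (fun j j' hj => (Prod.mk.inj (eR.symm.injective hj)).2) PE (hw ℓ) (hv r)
  have h3 := hgood
  rw [EtaGood, div_le_iff₀ (by positivity)] at h3
  rw [mul_comm (n : ℝ) d, ← div_div]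
  rw [div_le_iff₀ hn']
  refine h1.trans ?_
  have h4 := div_le_div_of_nonneg_right (h2.trans (add_le_add_right h3 _)) hn'.le
  refine (add_le_add_left h4 _).trans (le_of_eq ?_)
  field_simp
  ring

/-- sampling bound for common error indicators, reweighted by the
partition indicator `Λ_{ℓ,τ*}`. -/
theorem sos_sampling_bound
    {A : Type*} [Fintype A]
    (k n d : ℕ) (hk : 1 ≤ k) (hn : 0 < n) (hd : 0 < d)
    (ε β lam η : ℝ) (hε : 0 < ε) (hβ : 0 < β)
    (eR : Fin n × Fin d ≃ Fin n × Fin d)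
    (Cin : Set (Fin d → A))
    (hsing : SingularBound eR lam)
    (t : ℕ) (ht : 4 * k * d ≤ t)
    (PE : MvPolynomial (SoSVar k n d A) ℝ →ₗ[ℝ] ℝ)
    (hPE : IsPseudocodeword Cin PE t)
    (hgood : EtaGood eR PE η)
    (hlam : lam ≤ β * ε / (12 * (k : ℝ) ^ k))
    (hη : η ≤ β * ε / (12 * (k : ℝ) ^ k))
    (τ : Finpartition (Finset.univ : Finset (Fin k))) (hτ : 2 ≤ τ.parts.card)
    (hτmass : β / (k : ℝ) ^ k ≤ (∑ ℓ : Fin n, PE (Lam τ ℓ)) / n)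
    (g : Fin n × Fin d → A) :
    ∀ S : Finset (Fin k),
      ((∑ e : Fin n × Fin d, PE (Lam τ e.1 * Dpoly eR g S (eR e).1)) / ((n : ℝ) * d))
          / ((∑ ℓ : Fin n, PE (Lam τ ℓ)) / n)
        ≤ (∑ r : Fin n, PE (Dpoly eR g S r)) / n + ε / 6 ∧
      ((∑ e : Fin n × Fin d,
            PE (Lam τ e.1 * (Dpoly eR g S (eR e).1 - Dpoly eR g Finset.univ (eR e).1)))
            / ((n : ℝ) * d))
          / ((∑ ℓ : Fin n, PE (Lam τ ℓ)) / n)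
        ≤ (∑ r : Fin n, PE (Dpoly eR g S r - Dpoly eR g Finset.univ r)) / n + ε / 6 := by
  have hE := hPE.1
  have ht' : 4 * (k * d) ≤ t := by rwa [← mul_assoc]
  have hk' : (0 : ℝ) < (k : ℝ) ^ k := by
    have : (0 : ℝ) < k := by exact_mod_cast hk
    positivity
  set δ := β * ε / (12 * (k : ℝ) ^ k) with hδ
  have hδ0 : 0 < δ := by positivity
  have hs : SingularBound eR δ := fun x =>
    (hsing x).trans (mul_le_mul_of_nonneg_right hlam (Real.sqrt_nonneg _))
  have hgood' : EtaGood eR PE δ := le_trans hgood hη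
  have hm : 0 < (∑ ℓ : Fin n, PE (Lam τ ℓ)) / n := lt_of_lt_of_le (by positivity) hτmass
  have hLdeg : ∀ ℓ : Fin n, (Lam τ ℓ : MvPolynomial (SoSVar k n d A) ℝ).totalDegree ≤ k * d :=
    fun ℓ => by rw [Lam_eq_localPoly]; exact totalDegree_localPoly_le _ _
  have key : ∀ (v : Fin n → (Fin k → Fin d → A) → ℝ)
      (Q : Fin n → MvPolynomial (SoSVar k n d A) ℝ), (∀ r α, v r α = 0 ∨ v r α = 1) →
      (∀ r (p : MvPolynomial (SoSVar k n d A) ℝ), p.totalDegree ≤ k * d →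
        PE (p * Q r) = PE (p * localPoly (fun j => eR.symm (r, j)) (v r))) →
      ((∑ e : Fin n × Fin d, PE (Lam τ e.1 * Q (eR e).1)) / ((n : ℝ) * d))
          / ((∑ ℓ : Fin n, PE (Lam τ ℓ)) / n) ≤ (∑ r : Fin n, PE (Q r)) / n + ε / 6 := by
    intro v Q hv hQ
    have hQ1 : ∀ r, PE (Q r) = PE (localPoly (fun j => eR.symm (r, j)) (v r)) := fun r => by
      simpa using hQ r 1 (by simp)
    have h1 := hE.edge_correlation_le ht' hn hs hδ0 hgood'
      (w := fun _ α => if ∀ i i' : Fin k, (α i = α i' ↔ SamePart τ i i') then 1 else 0)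
      (v := v) (fun _ α => by split_ifs <;> simp) hv
    simp only [← Lam_eq_localPoly, ← hQ1] at h1
    rw [div_le_iff₀ hm]
    have h2 : ∀ e : Fin n × Fin d, PE (Lam τ e.1 * Q (eR e).1) = PE (Lam τ e.1
        * localPoly (fun j => eR.symm ((eR e).1, j)) (v (eR e).1)) := fun e => hQ _ _ (hLdeg _)
    simp only [h2]
    have h3 : δ + δ = ε / 6 * (β / (k : ℝ) ^ k) := by rw [hδ]; field_simp; ring
    have h4 := mul_le_mul_of_nonneg_left hτmass (by positivity : 0 ≤ ε / 6)
    linarith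
  intro S
  refine ⟨key (fun r => errIndicator (fun j => g (eR.symm (r, j))) S) _ (fun r α => ?_)
      fun r p hp => hE.map_mul_Dpoly ht' eR g S r hp,
    key (fun r α => errIndicator (fun j => g (eR.symm (r, j))) S α
      - errIndicator (fun j => g (eR.symm (r, j))) univ α)
      (fun r => Dpoly eR g S r - Dpoly eR g univ r) (fun r α => ?_) fun r p hp => ?_⟩
  · rw [errIndicator_eq]; split_ifs <;> simp
  · rw [errIndicator_eq, errIndicator_eq]
    split_ifs with h1 h2 h2
    · simp
    · simp
    · exact absurd (fun i _ => h2 i (Finset.mem_univ i)) h1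
    · simp
  · have hsub : ∀ (e : Fin d → Fin n × Fin d) (v v' : (Fin k → Fin d → A) → ℝ),
        localPoly e (fun α => v α - v' α) = localPoly e v - localPoly e v' := fun e v v' => by
      simp only [localPoly, sub_smul, Finset.sum_sub_distrib]
    rw [hsub, mul_sub, mul_sub, map_sub, map_sub, hE.map_mul_Dpoly ht' eR g S r hp,
      hE.map_mul_Dpoly ht' eR g univ r hp]
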